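/- arXiv:2207.14586 — 3 statements merged into one kernel-verified Lean document; each statement's English description precedes it below -/
import Mathlib

section
/- Let t ≥ 2 and r ≥ 2 be integers and let k, n be nonnegative integers. The number of partitions λ with λ_1 = k and |λ| − (λ_r + λ_{t+r} + λ_{2t+r} + ⋯) = n equals the number of ordered pairs (α, β) of partitions with ℓ(α) + ℓ(β) = k and |α| + |β| = n such that every part of β is of the form (r−1) + j(t−1) for some integer j ≥ 0. (This is the coefficient-wise form of the identity ∑_{λ∈𝒫} z^{λ_1} q^{|λ| − λ_r − λ_{t+r} − λ_{2t+r} − ⋯} = 1/((qz;q)_∞ (q^{r−1}z; q^{t−1})_∞).) -/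
/-- A partition: a weakly decreasing sequence of naturals with finite support.
`p.parts i` is the `(i+1)`-st part, i.e. parts are 0-indexed (`λ_1 = p.parts 0`). -/
structure Ptn where
  parts : ℕ → ℕ
  antitone' : ∀ ⦃i j : ℕ⦄, i ≤ j → parts j ≤ parts i
  finite_support' : (Function.support parts).Finite

namespace Ptn

/-- The size `|λ|` of a partition: the sum of all its parts. -/
noncomputable def size (p : Ptn) : ℕ := ∑ᶠ i, p.parts i

/-- The number of (nonzero) parts `ℓ(λ)`. -/
noncomputable def length (p : Ptn) : ℕ := (Function.support p.parts).ncard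

/-- A partition has distinct parts if no nonzero value is repeated. -/
def Distinct (p : Ptn) : Prop := ∀ i : ℕ, p.parts (i + 1) ≠ 0 → p.parts (i + 1) < p.parts i

/-- A partition has odd parts if every part is odd. -/
def OddParts (p : Ptn) : Prop := ∀ i : ℕ, p.parts i ≠ 0 → Odd (p.parts i)

end Ptn

namespace Ptn

theorem ext_parts {p q : Ptn} (h : p.parts = q.parts) : p = q := by
  cases p; cases q; cases h; rfl

theorem parts_ne_zero_iff (p : Ptn) (i : ℕ) : p.parts i ≠ 0 ↔ i < p.length := by
  classical
  have hex : ∃ N, p.parts N = 0 := by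
    by_contra! h
    exact Set.infinite_univ ((Set.eq_univ_of_forall (s := Function.support p.parts) h) ▸
      p.finite_support')
  have key : ∀ i, p.parts i ≠ 0 ↔ i < Nat.find hex := by
    intro i
    constructor
    · intro h
      by_contra! hle
      have h1 := p.antitone' hle
      have h2 := Nat.find_spec hex
      omega
    · exact fun h => Nat.find_min hex h
  have hs : Function.support p.parts = Set.Iio (Nat.find hex) := by
    ext i
    exact key i
  rw [key, length, hs]
  simp [Set.ncard_eq_toFinset_card']

/-- The nonzero parts of a partition, in weakly decreasing order. -/
noncomputable def partsList (p : Ptn) : List ℕ := (List.range p.length).map p.parts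

theorem getD_partsList (p : Ptn) (i : ℕ) : p.partsList.getD i 0 = p.parts i := by
  have := p.parts_ne_zero_iff i
  by_cases h : i < p.length
  · simp [partsList, h]
  · simp only [partsList, List.getD_eq_getElem?_getD]
    rw [List.getElem?_eq_none (by simpa using h)]
    simp only [Option.getD_none]
    tauto

theorem pairwise_partsList (p : Ptn) : p.partsList.Pairwise (· ≥ ·) := by
  rw [partsList, List.pairwise_map]
  exact List.pairwise_lt_range.imp fun h => p.antitone' h.le

/-- The multiset of nonzero parts of a partition. -/
noncomputable def partsMultiset (p : Ptn) : Multiset ℕ := p.partsList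

theorem card_partsMultiset (p : Ptn) : p.partsMultiset.card = p.length := by
  simp [partsMultiset, partsList]

theorem sum_partsMultiset (p : Ptn) : p.partsMultiset.sum = p.size := by
  rw [size, finsum_eq_sum_of_support_subset (s := Finset.range p.length)]
  · simp [partsMultiset, partsList, Finset.sum, Multiset.range]
  · intro i hi
    simpa using (p.parts_ne_zero_iff i).1 hi

theorem mem_partsMultiset (p : Ptn) (x : ℕ) :
    x ∈ p.partsMultiset ↔ ∃ i, p.parts i ≠ 0 ∧ p.parts i = x := by
  simp [partsMultiset, partsList, parts_ne_zero_iff]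

theorem partsMultiset_injective : Function.Injective partsMultiset := by
  intro p q h
  have hl : p.partsList = q.partsList :=
    (Multiset.coe_eq_coe.1 h).eq_of_pairwise' p.pairwise_partsList q.pairwise_partsList
  apply ext_parts
  funext i
  rw [← getD_partsList, hl, getD_partsList]

theorem exists_partsMultiset_eq {A : Multiset ℕ} (hA : 0 ∉ A) : ∃ p : Ptn, p.partsMultiset = A := by
  have hs : (A.sort (· ≥ ·)).Pairwise (· ≥ ·) := A.pairwise_sort _
  have hA' : (A.sort (· ≥ ·) : Multiset ℕ) = A := A.sort_eq _
  generalize A.sort (· ≥ ·) = l at hs hA'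
  subst hA'
  have hne : ∀ i, l.getD i 0 ≠ 0 ↔ i < l.length := by
    intro i
    by_cases h : i < l.length
    · simp only [List.getD_eq_getElem _ _ h, h, iff_true]
      intro h0
      exact hA (by simp [← h0])
    · simp [h]
  have hsupp : Function.support (fun i => l.getD i 0) = Set.Iio l.length := by
    ext i
    exact hne i
  let p : Ptn :=
    { parts := fun i => l.getD i 0
      antitone' := by
        intro i j hij
        by_cases h : j < l.length
        · rcases hij.eq_or_lt with rfl | hlt
          · exact le_rfl
          · simp only [List.getD_eq_getElem _ _ h, List.getD_eq_getElem _ _ (hij.trans_lt h)]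
            exact List.pairwise_iff_getElem.1 hs i j _ _ hlt
        · have := hne j
          omega
      finite_support' := hsupp ▸ Set.finite_Iio _ }
  have hlen : p.length = l.length := by
    change (Function.support (fun i => l.getD i 0)).ncard = _
    rw [hsupp]
    simp [Set.ncard_eq_toFinset_card']
  refine ⟨p, congrArg _ (List.ext_getElem (by simp [partsList, hlen]) ?_)⟩
  intro i h1 h2
  simp [partsList, p, h2]

/-- The partition whose conjugate has the parts `x + 1` for `x ∈ M`. -/
def ofConjugate (M : Multiset ℕ) : Ptn where
  parts i := M.countP (i ≤ ·)
  antitone' := by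
    intro i j hij
    simp only [Multiset.countP_eq_card_filter]
    exact Multiset.card_le_card (Multiset.monotone_filter_right M fun x h => hij.trans h)
  finite_support' := by
    refine (Set.finite_Iic M.sum).subset fun i hi => ?_
    obtain ⟨x, hx, hix⟩ := Multiset.countP_pos.1 (Nat.pos_of_ne_zero hi)
    exact hix.trans (Multiset.le_sum_of_mem hx)

theorem ofConjugate_parts (M : Multiset ℕ) (i : ℕ) :
    (ofConjugate M).parts i = M.countP (i ≤ ·) := rfl

theorem ofConjugate_parts_zero (M : Multiset ℕ) : (ofConjugate M).parts 0 = M.card := by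
  simp [ofConjugate_parts]

theorem finsum_ofConjugate_parts (M : Multiset ℕ) (f : ℕ → ℕ) (hf : ∀ x, {i | f i ≤ x}.Finite) :
    ∑ᶠ i, (ofConjugate M).parts (f i) = (M.map fun x => {i | f i ≤ x}.ncard).sum := by
  simp only [ofConjugate_parts]
  induction M using Multiset.induction with
  | empty => simp
  | cons x M ih =>
    simp only [Multiset.countP_cons, Multiset.map_cons, Multiset.sum_cons]
    rw [finsum_add_distrib, ih, add_comm]
    · congr 1
      rw [finsum_eq_sum_of_support_subset (s := (hf x).toFinset)]
      · rw [Set.ncard_eq_toFinset_card _ (hf x), Finset.card_eq_sum_ones]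
        exact Finset.sum_congr rfl fun i hi => if_pos (by simpa using hi)
      · intro i hi
        simpa using hi
    · refine (hf M.sum).subset fun i hi => ?_
      obtain ⟨y, hy, hiy⟩ := Multiset.countP_pos.1 (Nat.pos_of_ne_zero hi)
      exact hiy.trans (Multiset.le_sum_of_mem hy)
    · refine (hf x).subset fun i hi => ?_
      simpa using hi

theorem size_ofConjugate (M : Multiset ℕ) :
    (ofConjugate M).size = (M.map (· + 1)).sum := by
  rw [size, finsum_ofConjugate_parts M (fun i => i) Set.finite_Iic]
  congr 2
  funext x
  change (Set.Iic x).ncard = _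
  simp [Set.ncard_eq_toFinset_card']

theorem ofConjugate_injective : Function.Injective ofConjugate := by
  intro M N h
  have key : ∀ (K : Multiset ℕ) (i : ℕ), K.countP (i ≤ ·) = K.count i + K.countP (i + 1 ≤ ·) := by
    intro K i
    induction K using Multiset.induction with
    | empty => simp
    | cons x K ih =>
      simp only [Multiset.countP_cons, Multiset.count_cons, ih]
      split_ifs <;> omega
  have hp : ∀ i, M.countP (i ≤ ·) = N.countP (i ≤ ·) := fun i => congrArg (fun p => p.parts i) h
  ext i
  have h1 := key M i
  have h2 := key N i
  rw [hp i, hp (i + 1)] at h1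
  omega

theorem ofConjugate_surjective : Function.Surjective ofConjugate := by
  intro p
  have key : ∀ N i, (∑ j ∈ Finset.range N,
      Multiset.replicate (p.parts j - p.parts (j + 1)) j).countP (i ≤ ·) + p.parts (max i N) =
        p.parts i := by
    intro N i
    induction N with
    | zero => simp
    | succ N ih =>
      rw [Finset.sum_range_succ, Multiset.countP_add]
      have hrep : (Multiset.replicate (p.parts N - p.parts (N + 1)) N).countP (i ≤ ·) =
          if i ≤ N then p.parts N - p.parts (N + 1) else 0 := by
        rw [← Multiset.coe_replicate, Multiset.coe_countP, List.countP_replicate]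
        simp
      rw [hrep]
      have := p.antitone' (show N ≤ N + 1 by omega)
      split_ifs with h
      · rw [max_eq_right h] at ih
        rw [max_eq_right (by omega)]
        omega
      · rw [max_eq_left (by omega)] at ih ⊢
        omega
  refine ⟨∑ j ∈ Finset.range p.length, Multiset.replicate (p.parts j - p.parts (j + 1)) j,
    ext_parts (funext fun i => ?_)⟩
  have h := key p.length i
  have h0 : p.parts (max i p.length) = 0 := by
    have := p.parts_ne_zero_iff (max i p.length)
    omega
  rw [ofConjugate_parts]
  omega

end Ptn

namespace OppositeSchmidt

/-- The number of indices `m` with `m * t + s ≤ x`. -/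
def hits (t s x : ℕ) : ℕ := (x + t - s) / t

/-- The weight contributed by a column of height `x + 1`. -/
def weight (t s x : ℕ) : ℕ := x + 1 - hits t s x

/-- The index in the residue class of the omitted parts that has a given weight. -/
def omittedIndex (t s b : ℕ) : ℕ := s + (b - s) / (t - 1) * t

/-- The index outside the residue class of the omitted parts that has a given weight. -/
def keptIndex (t s a : ℕ) : ℕ :=
  if a ≤ s then a - 1 else s + (a - s - 1) / (t - 1) * t + (a - s - 1) % (t - 1) + 1

variable {t s : ℕ}

theorem lt_hits_iff (ht : 2 ≤ t) (m x : ℕ) : m < hits t s x ↔ m * t + s ≤ x := by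
  rw [hits, ← Nat.succ_le_iff, Nat.le_div_iff_mul_le (by omega), Nat.succ_mul]
  omega

theorem hits_of_lt (ht : 2 ≤ t) {x : ℕ} (h : x < s) : hits t s x = 0 :=
  Nat.div_eq_of_lt (by omega)

theorem hits_add (ht : 2 ≤ t) {q u : ℕ} (hu : u < t) : hits t s (s + q * t + u) = q + 1 := by
  rw [hits, show s + q * t + u + t - s = u + (q + 1) * t by rw [Nat.succ_mul]; omega,
    Nat.add_mul_div_right _ _ (by omega), Nat.div_eq_of_lt hu, zero_add]

theorem weight_of_lt (ht : 2 ≤ t) {x : ℕ} (h : x < s) : weight t s x = x + 1 := by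
  simp [weight, hits_of_lt ht h]

theorem mul_eq_mul_pred_add (ht : 2 ≤ t) (q : ℕ) : q * t = q * (t - 1) + q := by
  obtain ⟨v, rfl⟩ : ∃ v, t = v + 1 := ⟨t - 1, by omega⟩
  simp [Nat.mul_succ]

theorem weight_add (ht : 2 ≤ t) {q u : ℕ} (hu : u < t) :
    weight t s (s + q * t + u) = s + q * (t - 1) + u := by
  rw [weight, hits_add ht hu, mul_eq_mul_pred_add ht]
  omega

theorem hits_le (ht : 2 ≤ t) (x : ℕ) : hits t s x ≤ x + 1 := by
  by_contra! h
  have := (lt_hits_iff ht (x + 1) x).1 h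
  nlinarith

theorem weight_pos (ht : 2 ≤ t) (hs : 1 ≤ s) (x : ℕ) : 0 < weight t s x := by
  have h : hits t s x ≤ x := by
    by_contra! h
    have := (lt_hits_iff ht x x).1 h
    nlinarith
  rw [weight]
  omega

theorem exists_eq_add (ht : 2 ≤ t) {x : ℕ} (h : s ≤ x) : ∃ q, ∃ u < t, x = s + q * t + u :=
  ⟨(x - s) / t, (x - s) % t, Nat.mod_lt _ (by omega), by
    have := Nat.div_add_mod' (x - s) t
    omega⟩

theorem omittedIndex_add (ht : 2 ≤ t) (j : ℕ) : omittedIndex t s (s + j * (t - 1)) = s + j * t := by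
  rw [omittedIndex, Nat.add_sub_cancel_left, Nat.mul_div_cancel _ (by omega)]

theorem weight_add_mul (ht : 2 ≤ t) (j : ℕ) : weight t s (s + j * t) = s + j * (t - 1) :=
  weight_add (u := 0) ht (by omega)

theorem keptIndex_add (ht : 2 ≤ t) {q u : ℕ} (hu : u < t) (hu0 : 0 < u) :
    keptIndex t s (s + q * (t - 1) + u) = s + q * t + u := by
  rw [keptIndex, if_neg (by omega),
    show s + q * (t - 1) + u - s - 1 = (u - 1) + q * (t - 1) by omega,
    Nat.add_mul_div_right _ _ (by omega), Nat.add_mul_mod_self_right,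
    Nat.div_eq_of_lt (by omega), Nat.mod_eq_of_lt (by omega)]
  simp only [zero_add]
  omega

theorem keptIndex_weight (ht : 2 ≤ t) {x : ℕ} (hx : ¬ ∃ m, x = s + m * t) :
    keptIndex t s (weight t s x) = x := by
  rcases lt_or_ge x s with h | h
  · rw [weight_of_lt ht h, keptIndex, if_pos (by omega)]
    rfl
  · obtain ⟨q, u, hu, rfl⟩ := exists_eq_add ht h
    have hu0 : 0 < u := by
      by_contra! h0
      exact hx ⟨q, by omega⟩
    rw [weight_add ht hu, keptIndex_add ht hu hu0]

theorem keptIndex_spec (ht : 2 ≤ t) {a : ℕ} (ha : 0 < a) :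
    weight t s (keptIndex t s a) = a ∧ ¬ ∃ m, keptIndex t s a = s + m * t := by
  rcases le_or_gt a s with h | h
  · rw [keptIndex, if_pos h, weight_of_lt ht (by omega)]
    refine ⟨by omega, ?_⟩
    rintro ⟨m, hm⟩
    omega
  · obtain ⟨q, u, hu, hu0, rfl⟩ : ∃ q u, u < t ∧ 0 < u ∧ a = s + q * (t - 1) + u :=
      ⟨(a - s - 1) / (t - 1), (a - s - 1) % (t - 1) + 1, by
        have := Nat.mod_lt (a - s - 1) (show 0 < t - 1 by omega)
        omega, by omega, by
        have := Nat.div_add_mod' (a - s - 1) (t - 1)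
        omega⟩
    rw [keptIndex_add ht hu hu0]
    refine ⟨weight_add ht hu, ?_⟩
    rintro ⟨m, hm⟩
    have h1 := congrArg (· % t) (show q * t + u = m * t by omega)
    simp [Nat.mod_eq_of_lt hu] at h1
    omega

theorem ncard_multiset_eq (ht : 2 ≤ t) (hs : 1 ≤ s) (k n : ℕ) :
    {M : Multiset ℕ | M.card = k ∧ (M.map (weight t s)).sum = n}.ncard =
      {P : Multiset ℕ × Multiset ℕ | P.1.card + P.2.card = k ∧ P.1.sum + P.2.sum = n ∧
        0 ∉ P.1 ∧ ∀ x ∈ P.2, ∃ j, x = s + j * (t - 1)}.ncard := by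
  classical
  let S : ℕ → Prop := fun x => ∃ m, x = s + m * t
  have hkept : ∀ A : Multiset ℕ, 0 ∉ A →
      (A.map (keptIndex t s)).map (weight t s) = A ∧ ∀ x ∈ A.map (keptIndex t s), ¬ S x := by
    intro A hA
    have hpos : ∀ a ∈ A, 0 < a := fun a ha => Nat.pos_of_ne_zero fun h => hA (h ▸ ha)
    refine ⟨?_, ?_⟩
    · rw [Multiset.map_map]
      exact (Multiset.map_congr rfl fun a ha => (keptIndex_spec ht (hpos a ha)).1).trans
        (Multiset.map_id A)
    · intro x hx
      obtain ⟨a, ha, rfl⟩ := Multiset.mem_map.1 hx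
      exact (keptIndex_spec ht (hpos a ha)).2
  have homit : ∀ B : Multiset ℕ, (∀ x ∈ B, ∃ j, x = s + j * (t - 1)) →
      (B.map (omittedIndex t s)).map (weight t s) = B ∧ ∀ x ∈ B.map (omittedIndex t s), S x := by
    intro B hB
    refine ⟨?_, ?_⟩
    · rw [Multiset.map_map]
      refine (Multiset.map_congr rfl fun b hb => ?_).trans (Multiset.map_id B)
      obtain ⟨j, rfl⟩ := hB b hb
      simp [omittedIndex_add ht, weight_add_mul ht]
    · intro x hx
      obtain ⟨b, hb, rfl⟩ := Multiset.mem_map.1 hx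
      obtain ⟨j, rfl⟩ := hB b hb
      exact ⟨j, omittedIndex_add ht j⟩
  have hbij : Set.BijOn (fun P : Multiset ℕ × Multiset ℕ =>
      P.1.map (keptIndex t s) + P.2.map (omittedIndex t s))
      {P | P.1.card + P.2.card = k ∧ P.1.sum + P.2.sum = n ∧
        0 ∉ P.1 ∧ ∀ x ∈ P.2, ∃ j, x = s + j * (t - 1)}
      {M | M.card = k ∧ (M.map (weight t s)).sum = n} := by
    refine Set.InvOn.bijOn (f' := fun M => ((M.filter fun x => ¬ S x).map (weight t s),
      (M.filter S).map (weight t s))) ⟨?_, ?_⟩ ?_ ?_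
    · rintro ⟨A, B⟩ ⟨-, -, hA, hB⟩
      obtain ⟨hA1, hA2⟩ := hkept A hA
      obtain ⟨hB1, hB2⟩ := homit B hB
      simp only [Multiset.filter_add]
      rw [Multiset.filter_eq_self.2 hA2, Multiset.filter_eq_self.2 hB2,
        Multiset.filter_eq_nil.2 hA2,
        Multiset.filter_eq_nil.2 fun x hx => not_not.2 (hB2 x hx), add_zero, zero_add, hA1, hB1]
    · intro M _
      simp only [Multiset.map_map]
      rw [Multiset.map_congr (g := id) rfl, Multiset.map_congr (s := M.filter S) (g := id) rfl,
        Multiset.map_id, Multiset.map_id, add_comm, Multiset.filter_add_not]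
      · intro x hx
        obtain ⟨m, rfl⟩ := (Multiset.mem_filter.1 hx).2
        simp [weight_add_mul ht, omittedIndex_add ht]
      · exact fun x hx => keptIndex_weight ht (Multiset.mem_filter.1 hx).2
    · rintro ⟨A, B⟩ ⟨h1, h2, hA, hB⟩
      refine ⟨by simpa using h1, ?_⟩
      rw [Multiset.map_add, (hkept A hA).1, (homit B hB).1, Multiset.sum_add]
      exact h2
    · rintro M ⟨h1, h2⟩
      refine ⟨?_, ?_, ?_, ?_⟩
      · simp only [Multiset.card_map]
        rw [← Multiset.card_add, add_comm, Multiset.filter_add_not, h1]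
      · rw [← Multiset.sum_add, ← Multiset.map_add, add_comm, Multiset.filter_add_not, h2]
      · intro h0
        obtain ⟨x, -, hx⟩ := Multiset.mem_map.1 h0
        exact (weight_pos ht hs x).ne' hx
      · intro x hx
        obtain ⟨y, hy, rfl⟩ := Multiset.mem_map.1 hx
        obtain ⟨m, rfl⟩ := (Multiset.mem_filter.1 hy).2
        exact ⟨m, weight_add_mul ht m⟩
  exact hbij.ncard_eq.symm

theorem finsum_omitted_ofConjugate (ht : 2 ≤ t) (M : Multiset ℕ) :
    ∑ᶠ m, (Ptn.ofConjugate M).parts (m * t + s) = (M.map (hits t s)).sum := by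
  have hset : ∀ x, {m | m * t + s ≤ x} = Set.Iio (hits t s x) := by
    intro x
    ext m
    exact (lt_hits_iff ht m x).symm
  rw [Ptn.finsum_ofConjugate_parts M _ fun x => hset x ▸ Set.finite_Iio _]
  congr 2
  funext x
  rw [hset]
  simp [Set.ncard_eq_toFinset_card']

theorem size_eq_iff (ht : 2 ≤ t) (M : Multiset ℕ) (n : ℕ) :
    (Ptn.ofConjugate M).size = (∑ᶠ m, (Ptn.ofConjugate M).parts (m * t + s)) + n ↔
      (M.map (weight t s)).sum = n := by
  have h : (M.map (· + 1)).sum = (M.map (hits t s)).sum + (M.map (weight t s)).sum := by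
    rw [← Multiset.sum_map_add]
    congr 2
    funext x
    have := hits_le (s := s) ht x
    rw [weight]
    omega
  rw [Ptn.size_ofConjugate, finsum_omitted_ofConjugate ht, h]
  omega

end OppositeSchmidt

/-- Coefficient-wise form of
`∑_{λ∈𝒫} z^{λ_1} q^{|λ| - λ_r - λ_{t+r} - λ_{2t+r} - ⋯}
  = 1/((qz;q)_∞ (q^{r-1}z; q^{t-1})_∞)`:
partitions `λ` with `λ_1 = k` and `|λ| - (λ_r + λ_{t+r} + λ_{2t+r} + ⋯) = n` are
equinumerous with pairs `(α, β)` of partitions with `ℓ(α) + ℓ(β) = k`, `|α| + |β| = n`,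
and every part of `β` of the form `(r-1) + j(t-1)` for some `j ≥ 0`. -/
theorem opposite_schmidt (t r : ℕ) (ht : 2 ≤ t) (hr : 2 ≤ r) (k n : ℕ) :
    {p : Ptn | p.parts 0 = k ∧
        p.size = (∑ᶠ m : ℕ, p.parts (m * t + r - 1)) + n}.ncard
      = {q : Ptn × Ptn | q.1.length + q.2.length = k ∧ q.1.size + q.2.size = n ∧
          ∀ i : ℕ, q.2.parts i ≠ 0 → ∃ j : ℕ, q.2.parts i = (r - 1) + j * (t - 1)}.ncard := by
  obtain ⟨s, rfl⟩ : ∃ s, r = s + 1 := ⟨r - 1, by omega⟩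
  simp only [Nat.add_sub_cancel, ← Nat.add_assoc]
  have hl := Set.ncard_preimage_of_injective_subset_range
    (s := {p : Ptn | p.parts 0 = k ∧ p.size = (∑ᶠ m : ℕ, p.parts (m * t + s)) + n})
    Ptn.ofConjugate_injective (by simp [Ptn.ofConjugate_surjective.range_eq])
  have hr := Set.ncard_preimage_of_injective_subset_range
    (s := {P : Multiset ℕ × Multiset ℕ | P.1.card + P.2.card = k ∧ P.1.sum + P.2.sum = n ∧
        0 ∉ P.1 ∧ ∀ x ∈ P.2, ∃ j, x = s + j * (t - 1)})
    (Ptn.partsMultiset_injective.prodMap Ptn.partsMultiset_injective) (by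
      rintro ⟨A, B⟩ ⟨-, -, hA, hB⟩
      obtain ⟨p, rfl⟩ := Ptn.exists_partsMultiset_eq hA
      obtain ⟨q, rfl⟩ := Ptn.exists_partsMultiset_eq (A := B) fun h0 => by
        obtain ⟨j, hj⟩ := hB 0 h0
        omega
      exact ⟨(p, q), rfl⟩)
  rw [← hl]
  refine Eq.trans ?_ ((OppositeSchmidt.ncard_multiset_eq ht (by omega) k n).trans
    (hr.symm.trans ?_))
  · congr 1
    ext M
    simp only [Set.mem_preimage, Set.mem_ofPred_eq, Ptn.ofConjugate_parts_zero,
      OppositeSchmidt.size_eq_iff ht]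
  · congr 1
    ext ⟨p, q⟩
    simp [Ptn.card_partsMultiset, Ptn.sum_partsMultiset, Ptn.mem_partsMultiset]
end

section
/- For all nonnegative integers a and b, the number of partitions λ with distinct parts such that ℓ(λ) ≡ 0 or 3 (mod 4), λ_1 = a, and λ_1 + λ_5 + λ_9 + ⋯ = b equals the number of partitions μ whose Durfee size d(μ) is even such that h_1(μ) = a and h_1(μ) + h_3(μ) + h_5(μ) + ⋯ = b, where the sum is over odd indices i ≤ d(μ). (The empty partition, with d = 0, contributes to a = b = 0.) -/
namespace Ptn

/-- The conjugate partition evaluated 1-based: `conj p i = λ'_i = #{j : λ_j ≥ i}`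
(meaningful for `i ≥ 1`). -/
noncomputable def conj (p : Ptn) (i : ℕ) : ℕ := {j : ℕ | i ≤ p.parts j}.ncard

/-- The Durfee size: the largest `i` with `λ_i ≥ i` (1-based), i.e. the number of
0-based indices `i` with `parts i ≥ i + 1`. -/
noncomputable def durfee (p : Ptn) : ℕ := {i : ℕ | i + 1 ≤ p.parts i}.ncard

/-- The `i`-th diagonal hook length (1-based, for `1 ≤ i ≤ durfee p`):
`h_i(λ) = λ_i + λ'_i - 2i + 1`. -/
noncomputable def hook (p : Ptn) (i : ℕ) : ℕ := p.parts (i - 1) + p.conj i + 1 - 2 * i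

end Ptn

theorem Nat.lt_ncard_iff_mem {D : Set ℕ} (hfin : D.Finite)
    (hdown : ∀ ⦃i j⦄, i ≤ j → j ∈ D → i ∈ D) (i : ℕ) : i < D.ncard ↔ i ∈ D := by
  constructor
  · intro h
    by_contra hi
    have hsub : D ⊆ Set.Iio i := fun j hj => by
      by_contra hij
      exact hi (hdown (not_lt.mp hij) hj)
    have := Set.ncard_le_ncard hsub (Set.finite_Iio i)
    rw [Set.ncard_Iio_nat] at this
    omega
  · intro hi
    have hsub : Set.Iio (i + 1) ⊆ D := fun j hj => hdown (Nat.lt_succ_iff.mp hj) hi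
    have := Set.ncard_le_ncard hsub hfin
    rw [Set.ncard_Iio_nat] at this
    omega

namespace Ptn

theorem eq_of_parts_eq {p q : Ptn} (h : ∀ i, p.parts i = q.parts i) : p = q := by
  cases p
  cases q
  congr
  exact funext h

theorem finite_setOf_le_parts (p : Ptn) (f : ℕ → ℕ) (hf : ∀ i, 0 < f i) :
    {i | f i ≤ p.parts i}.Finite :=
  p.finite_support'.subset fun i hi => by
    have := hf i
    simp only [Set.mem_ofPred_eq, Function.mem_support] at hi ⊢
    omega

theorem lt_length_iff (p : Ptn) (i : ℕ) : i < p.length ↔ p.parts i ≠ 0 := by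
  refine Nat.lt_ncard_iff_mem p.finite_support' (fun i j hij hj => ?_) i
  have := p.antitone' hij
  simp only [Function.mem_support] at hj ⊢
  omega

theorem lt_durfee_iff (p : Ptn) (i : ℕ) : i < p.durfee ↔ i + 1 ≤ p.parts i := by
  refine Nat.lt_ncard_iff_mem (p.finite_setOf_le_parts _ fun i => i.succ_pos)
    (fun i j hij hj => ?_) i
  have := p.antitone' hij
  simp only [Set.mem_ofPred_eq] at hj ⊢
  omega

theorem lt_conj_succ_iff (p : Ptn) (i j : ℕ) : i < p.conj (j + 1) ↔ j + 1 ≤ p.parts i :=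
  Nat.lt_ncard_iff_mem (p.finite_setOf_le_parts (fun _ => j + 1) fun _ => j.succ_pos)
    (fun _ _ hij hj => le_trans hj (p.antitone' hij)) i

end Ptn

/-- `s` is strictly decreasing and positive up to index `n`, and zero from index `n` on. -/
structure StrictSeq (n : ℕ) (s : ℕ → ℕ) : Prop where
  lt : ∀ i < n, s (i + 1) < s i
  zero : ∀ i, n ≤ i → s i = 0

namespace StrictSeq

variable {n : ℕ} {s : ℕ → ℕ}

theorem antitone (h : StrictSeq n s) : Antitone s :=
  antitone_nat_of_succ_le fun i => by
    rcases lt_or_ge i n with hi | hi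
    · exact (h.lt i hi).le
    · rw [h.zero i hi, h.zero (i + 1) (by omega)]

theorem pos (h : StrictSeq n s) {i : ℕ} (hi : i < n) : 0 < s i :=
  (Nat.zero_le _).trans_lt (h.lt i hi)

theorem add_index_le (h : StrictSeq n s) {i j : ℕ} (hij : i ≤ j) (hj : j < n) :
    s j + j ≤ s i + i := by
  induction j, hij using Nat.le_induction with
  | base => rfl
  | succ j hij ih =>
    have := h.lt j (by omega)
    have := ih (by omega)
    omega

theorem le_add_index (h : StrictSeq n s) {i : ℕ} (hi : i < n) : n ≤ s i + i := by
  have := h.add_index_le (Nat.le_sub_one_of_lt hi) (by omega)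
  have := h.pos (i := n - 1) (by omega)
  omega

theorem tail {m : ℕ} (h : StrictSeq (n + m) s) : StrictSeq n fun i => s (i + m) where
  lt i hi := by
    have := h.lt (i + m) (by omega)
    rwa [show i + 1 + m = i + m + 1 by omega]
  zero i hi := h.zero _ (by omega)

end StrictSeq

/-- Interleaves the gaps of two sequences, two gaps of `α` and two gaps of `β` at a time. -/
def interleave (α β : ℕ → ℕ) (i : ℕ) : ℕ :=
  α ((i + 3) / 4 + (i + 2) / 4) + β ((i + 1) / 4 + i / 4)

theorem interleave_four_mul (α β : ℕ → ℕ) (k : ℕ) :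
    interleave α β (4 * k) = α (2 * k) + β (2 * k) := by
  unfold interleave
  congr 2 <;> omega

theorem interleave_add_four (α β : ℕ → ℕ) (i : ℕ) :
    interleave α β (i + 4) = interleave (fun j => α (j + 2)) (fun j => β (j + 2)) i := by
  unfold interleave
  congr 2 <;> omega

theorem StrictSeq.interleave {k : ℕ} {α β : ℕ → ℕ} (hα : StrictSeq (2 * k) α)
    (hβ : StrictSeq (2 * k) β) : StrictSeq (4 * k) (interleave α β) where
  lt i hi := by
    unfold _root_.interleave
    by_cases h : i % 4 < 2
    · have h₁ : (i + 1 + 3) / 4 + (i + 1 + 2) / 4 = (i + 3) / 4 + (i + 2) / 4 + 1 := by omega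
      have h₂ : (i + 1 + 1) / 4 + (i + 1) / 4 = (i + 1) / 4 + i / 4 := by omega
      rw [h₁, h₂]
      exact Nat.add_lt_add_right (hα.lt _ (by omega)) _
    · have h₁ : (i + 1 + 3) / 4 + (i + 1 + 2) / 4 = (i + 3) / 4 + (i + 2) / 4 := by omega
      have h₂ : (i + 1 + 1) / 4 + (i + 1) / 4 = (i + 1) / 4 + i / 4 + 1 := by omega
      rw [h₁, h₂]
      exact Nat.add_lt_add_left (hβ.lt _ (by omega)) _
  zero i hi := by
    unfold _root_.interleave
    rw [hα.zero _ (by omega), hβ.zero _ (by omega)]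

theorem interleave_injective {k : ℕ} {α β α' β' : ℕ → ℕ} (hα : StrictSeq (2 * k) α)
    (hβ : StrictSeq (2 * k) β) (hα' : StrictSeq (2 * k) α') (hβ' : StrictSeq (2 * k) β')
    (h : ∀ i, interleave α β i = interleave α' β' i) : α = α' ∧ β = β' := by
  induction k generalizing α β α' β' with
  | zero =>
    constructor <;> funext i
    · rw [hα.zero i (by omega), hα'.zero i (by omega)]
    · rw [hβ.zero i (by omega), hβ'.zero i (by omega)]
  | succ k ih =>
    obtain ⟨htα, htβ⟩ := ih (hα.tail (m := 2)) (hβ.tail (m := 2)) (hα'.tail (m := 2))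
      (hβ'.tail (m := 2)) fun i => by
        rw [← interleave_add_four, ← interleave_add_four, h]
    have hα2 : α 2 = α' 2 := congrFun htα 0
    have h0 := h 0
    have h1 := h 1
    have h2 := h 2
    have h3 := h 3
    simp only [interleave, Nat.reduceAdd, Nat.reduceDiv] at h0 h1 h2 h3
    constructor <;> funext i
    · match i with
      | 0 => omega
      | 1 => omega
      | i + 2 => exact congrFun htα i
    · match i with
      | 0 => omega
      | 1 => omega
      | i + 2 => exact congrFun htβ i

theorem exists_interleave_eq {k : ℕ} {s : ℕ → ℕ} (hs : StrictSeq (4 * k) s) :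
    ∃ α β, StrictSeq (2 * k) α ∧ StrictSeq (2 * k) β ∧ ∀ i, interleave α β i = s i := by
  induction k generalizing s with
  | zero =>
    refine ⟨0, 0, ⟨fun i hi => ?_, fun i _ => rfl⟩, ⟨fun i hi => ?_, fun i _ => rfl⟩, fun i => ?_⟩
    · omega
    · omega
    · rw [hs.zero i (by omega)]
      rfl
  | succ k ih =>
    obtain ⟨α, β, hα, hβ, h⟩ := ih (hs.tail (m := 4))
    have h4 : α 0 + β 0 = s 4 := h 0
    have l0 : s 1 < s 0 := hs.lt 0 (by omega)
    have l1 : s 2 < s 1 := hs.lt 1 (by omega)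
    have l2 : s 3 < s 2 := hs.lt 2 (by omega)
    have l3 : s 4 < s 3 := hs.lt 3 (by omega)
    let α' : ℕ → ℕ
      | 0 => α 0 + (s 0 - s 2)
      | 1 => α 0 + (s 1 - s 2)
      | i + 2 => α i
    let β' : ℕ → ℕ
      | 0 => β 0 + (s 2 - s 4)
      | 1 => β 0 + (s 3 - s 4)
      | i + 2 => β i
    refine ⟨α', β', ⟨fun i hi => ?_, fun i hi => ?_⟩, ⟨fun i hi => ?_, fun i hi => ?_⟩,
      fun i => ?_⟩
    · match i with
      | 0 => simp only [α']; omega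
      | 1 => simp only [α']; omega
      | i + 2 => exact hα.lt i (by omega)
    · match i with
      | 0 => omega
      | 1 => omega
      | i + 2 => exact hα.zero i (by omega)
    · match i with
      | 0 => simp only [β']; omega
      | 1 => simp only [β']; omega
      | i + 2 => exact hβ.lt i (by omega)
    · match i with
      | 0 => omega
      | 1 => omega
      | i + 2 => exact hβ.zero i (by omega)
    · match i with
      | 0 => change α 0 + (s 0 - s 2) + (β 0 + (s 2 - s 4)) = s 0; omega
      | 1 => change α 0 + (s 1 - s 2) + (β 0 + (s 2 - s 4)) = s 1; omega
      | 2 => change α 0 + (β 0 + (s 2 - s 4)) = s 2; omega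
      | 3 => change α 0 + (β 0 + (s 3 - s 4)) = s 3; omega
      | i + 4 =>
        rw [interleave_add_four]
        exact h i

/-- Frobenius coordinates, each shifted up by one, of a partition of Durfee size `2 * half`. -/
structure EvenFrobenius where
  half : ℕ
  arm : ℕ → ℕ
  leg : ℕ → ℕ
  arm_strict : StrictSeq (2 * half) arm
  leg_strict : StrictSeq (2 * half) leg

namespace EvenFrobenius

/-- The first diagonal hook length. -/
def firstHook (x : EvenFrobenius) : ℕ := x.arm 0 + x.leg 0 - 1

/-- The sum of the diagonal hook lengths at odd (one-based) indices. -/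
def oddHookSum (x : EvenFrobenius) : ℕ :=
  ∑ k ∈ Finset.range x.half, (x.arm (2 * k) + x.leg (2 * k) - 1)

theorem eq_of_half_eq {x y : EvenFrobenius} (hk : x.half = y.half) (hα : x.arm = y.arm)
    (hβ : x.leg = y.leg) : x = y := by
  cases x
  cases y
  simp_all

/-- The partition obtained by interleaving the gaps of the Frobenius coordinates. -/
def toDistinct (x : EvenFrobenius) : Ptn where
  parts i := interleave x.arm x.leg i - 1
  antitone' _ _ hij :=
    Nat.sub_le_sub_right ((x.arm_strict.interleave x.leg_strict).antitone hij) 1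
  finite_support' := (Set.finite_Iio (4 * x.half)).subset fun i hi => by
    by_contra hik
    apply hi
    change interleave x.arm x.leg i - 1 = 0
    rw [(x.arm_strict.interleave x.leg_strict).zero i (by simpa using hik)]

theorem interleave_eq_toDistinct_parts (x : EvenFrobenius) (i : ℕ) :
    interleave x.arm x.leg i = if i < 4 * x.half then x.toDistinct.parts i + 1 else 0 := by
  have hs := x.arm_strict.interleave x.leg_strict
  split_ifs with h
  · exact (Nat.sub_add_cancel (hs.pos h)).symm
  · exact hs.zero i (by omega)

theorem toDistinct_distinct (x : EvenFrobenius) : x.toDistinct.Distinct := by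
  intro i hi
  have hs := x.arm_strict.interleave x.leg_strict
  change interleave x.arm x.leg (i + 1) - 1 ≠ 0 at hi
  change interleave x.arm x.leg (i + 1) - 1 < interleave x.arm x.leg i - 1
  have hik : i < 4 * x.half := by
    by_contra h
    rw [hs.zero (i + 1) (by omega)] at hi
    exact hi rfl
  have := hs.lt i hik
  omega

theorem toDistinct_length (x : EvenFrobenius) :
    x.toDistinct.length = 4 * x.half ∨ x.toDistinct.length + 1 = 4 * x.half := by
  have hs := x.arm_strict.interleave x.leg_strict
  have hle : ¬ 4 * x.half < x.toDistinct.length := by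
    rw [Ptn.lt_length_iff]
    change ¬ interleave x.arm x.leg (4 * x.half) - 1 ≠ 0
    rw [hs.zero _ le_rfl]
    simp
  rcases Nat.eq_zero_or_pos x.half with h0 | h0
  · omega
  · have hge : 4 * x.half - 2 < x.toDistinct.length := by
      rw [Ptn.lt_length_iff]
      change interleave x.arm x.leg (4 * x.half - 2) - 1 ≠ 0
      have := hs.lt (4 * x.half - 2) (by omega)
      have := hs.pos (i := 4 * x.half - 2 + 1) (by omega)
      omega
    omega

theorem toDistinct_parts_zero (x : EvenFrobenius) : x.toDistinct.parts 0 = x.firstHook := rfl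

theorem finsum_toDistinct_parts (x : EvenFrobenius) :
    ∑ᶠ k : ℕ, x.toDistinct.parts (4 * k) = x.oddHookSum := by
  rw [finsum_eq_sum_of_support_subset (s := Finset.range x.half)]
  · refine Finset.sum_congr rfl fun k _ => ?_
    change interleave x.arm x.leg (4 * k) - 1 = _
    rw [interleave_four_mul]
  · intro k hk
    by_contra h
    apply hk
    change interleave x.arm x.leg (4 * k) - 1 = 0
    rw [(x.arm_strict.interleave x.leg_strict).zero]
    simpa using h

theorem toDistinct_injective : Function.Injective toDistinct := by
  intro x y h
  have hk : x.half = y.half := by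
    have := x.toDistinct_length
    have := y.toDistinct_length
    rw [h] at *
    omega
  obtain ⟨hα, hβ⟩ := interleave_injective x.arm_strict x.leg_strict (hk ▸ y.arm_strict)
    (hk ▸ y.leg_strict) fun i => by
      rw [interleave_eq_toDistinct_parts, interleave_eq_toDistinct_parts, h, hk]
  exact eq_of_half_eq hk hα hβ

theorem exists_toDistinct_eq {p : Ptn} (hp : p.Distinct)
    (hl : p.length % 4 = 0 ∨ p.length % 4 = 3) : ∃ x : EvenFrobenius, x.toDistinct = p := by
  obtain ⟨k, hk⟩ : ∃ k, p.length = 4 * k ∨ p.length + 1 = 4 * k :=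
    ⟨(p.length + 1) / 4, by omega⟩
  have hs : StrictSeq (4 * k) fun i => if i < 4 * k then p.parts i + 1 else 0 := by
    refine ⟨fun i hi => ?_, fun i hi => if_neg (by omega)⟩
    simp only [hi, if_true]
    split_ifs with h
    · have h₀ := (p.lt_length_iff i).mp (by omega)
      have := hp i
      omega
    · omega
  obtain ⟨α, β, hα, hβ, h⟩ := exists_interleave_eq hs
  refine ⟨⟨k, α, β, hα, hβ⟩, Ptn.eq_of_parts_eq fun i => ?_⟩
  change interleave α β i - 1 = p.parts i
  rw [h]
  have := p.lt_length_iff i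
  split_ifs <;> omega

/-- The number of columns, among the first `2 * half`, that reach below row `i`. -/
noncomputable def columnCount (x : EvenFrobenius) (i : ℕ) : ℕ :=
  {j | j < 2 * x.half ∧ i < x.leg j + j}.ncard

theorem lt_columnCount_iff (x : EvenFrobenius) (i j : ℕ) :
    j < x.columnCount i ↔ j < 2 * x.half ∧ i < x.leg j + j :=
  Nat.lt_ncard_iff_mem (D := {j | j < 2 * x.half ∧ i < x.leg j + j})
    ((Set.finite_Iio (2 * x.half)).subset fun _ h => h.1)
    (fun _ _ hij h => ⟨hij.trans_lt h.1, h.2.trans_le (x.leg_strict.add_index_le hij h.1)⟩) j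

theorem columnCount_le (x : EvenFrobenius) (i : ℕ) : x.columnCount i ≤ 2 * x.half := by
  by_contra! h
  exact lt_irrefl _ ((x.lt_columnCount_iff i _).mp h).1

theorem columnCount_antitone (x : EvenFrobenius) : Antitone x.columnCount := by
  intro i j hij
  refine le_of_forall_lt fun m hm => ?_
  rw [lt_columnCount_iff] at hm ⊢
  exact ⟨hm.1, hij.trans_lt hm.2⟩

/-- The partition with the given Frobenius coordinates. -/
noncomputable def toPtn (x : EvenFrobenius) : Ptn where
  parts i := if i < 2 * x.half then x.arm i + i else x.columnCount i
  antitone' i j hij := by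
    split_ifs with hj hi hi
    · exact x.arm_strict.add_index_le hij hj
    · omega
    · exact (x.columnCount_le j).trans (x.arm_strict.le_add_index hi)
    · exact x.columnCount_antitone hij
  finite_support' := (Set.finite_Iio (2 * x.half + x.leg 0)).subset fun i hi => by
    by_contra hik
    rw [Set.mem_Iio, not_lt] at hik
    rw [Function.mem_support, if_neg (by omega), ← Nat.pos_iff_ne_zero, lt_columnCount_iff] at hi
    omega

theorem toPtn_parts_of_lt (x : EvenFrobenius) {i : ℕ} (hi : i < 2 * x.half) :
    x.toPtn.parts i = x.arm i + i := if_pos hi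

theorem toPtn_parts_of_le (x : EvenFrobenius) {i : ℕ} (hi : 2 * x.half ≤ i) :
    x.toPtn.parts i = x.columnCount i := if_neg (by omega)

theorem toPtn_durfee (x : EvenFrobenius) : x.toPtn.durfee = 2 * x.half := by
  refine eq_of_forall_lt_iff fun i => ?_
  rw [Ptn.lt_durfee_iff]
  rcases lt_or_ge i (2 * x.half) with hi | hi
  · have := x.arm_strict.pos hi
    rw [x.toPtn_parts_of_lt hi]
    omega
  · have := x.columnCount_le i
    rw [x.toPtn_parts_of_le hi]
    omega

theorem toPtn_conj (x : EvenFrobenius) {j : ℕ} (hj : j < 2 * x.half) :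
    x.toPtn.conj (j + 1) = x.leg j + j := by
  refine eq_of_forall_lt_iff fun i => ?_
  rw [Ptn.lt_conj_succ_iff]
  rcases lt_or_ge i (2 * x.half) with hi | hi
  · have := x.arm_strict.le_add_index hi
    have := x.leg_strict.le_add_index hj
    rw [x.toPtn_parts_of_lt hi]
    omega
  · rw [x.toPtn_parts_of_le hi, Nat.succ_le_iff, lt_columnCount_iff]
    exact and_iff_right hj

theorem toPtn_hook (x : EvenFrobenius) {i : ℕ} (hi : i < 2 * x.half) :
    x.toPtn.hook (i + 1) = x.arm i + x.leg i - 1 := by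
  unfold Ptn.hook
  rw [x.toPtn_conj hi, Nat.add_sub_cancel, x.toPtn_parts_of_lt hi]
  omega

theorem toPtn_hook_one (x : EvenFrobenius) : x.toPtn.hook 1 = x.firstHook := by
  rcases Nat.eq_zero_or_pos x.half with h0 | h0
  · have hd : ∀ i, ¬ i < x.toPtn.durfee := by
      simp [x.toPtn_durfee, h0]
    have hp : x.toPtn.parts 0 = 0 := by
      have := (x.toPtn.lt_durfee_iff 0).not.mp (hd 0)
      omega
    have hc : x.toPtn.conj 1 = 0 := by
      by_contra h
      have := (x.toPtn.lt_conj_succ_iff 0 0).mp (Nat.pos_of_ne_zero h)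
      omega
    unfold Ptn.hook firstHook
    rw [x.arm_strict.zero 0 (by omega), x.leg_strict.zero 0 (by omega), hc, Nat.sub_self, hp]
  · exact x.toPtn_hook (i := 0) (by omega)

theorem sum_toPtn_hook (x : EvenFrobenius) :
    ∑ k ∈ Finset.range ((x.toPtn.durfee + 1) / 2), x.toPtn.hook (2 * k + 1) = x.oddHookSum := by
  rw [x.toPtn_durfee, show (2 * x.half + 1) / 2 = x.half by omega]
  refine Finset.sum_congr rfl fun k hk => x.toPtn_hook ?_
  have := Finset.mem_range.mp hk
  omega

theorem toPtn_injective : Function.Injective toPtn := by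
  intro x y h
  have hk : x.half = y.half := by
    have := x.toPtn_durfee
    have := y.toPtn_durfee
    rw [h] at *
    omega
  refine eq_of_half_eq hk (funext fun i => ?_) (funext fun i => ?_)
  · rcases lt_or_ge i (2 * x.half) with hi | hi
    · have := x.toPtn_parts_of_lt hi
      rw [h, y.toPtn_parts_of_lt (hk ▸ hi)] at this
      omega
    · rw [x.arm_strict.zero i hi, y.arm_strict.zero i (hk ▸ hi)]
  · rcases lt_or_ge i (2 * x.half) with hi | hi
    · have := x.toPtn_conj hi
      rw [h, y.toPtn_conj (hk ▸ hi)] at this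
      omega
    · rw [x.leg_strict.zero i hi, y.leg_strict.zero i (hk ▸ hi)]

theorem exists_toPtn_eq {p : Ptn} (hp : Even p.durfee) : ∃ x : EvenFrobenius, x.toPtn = p := by
  obtain ⟨k, hk⟩ := hp
  have hle : ∀ i j, i < 2 * k → j < 2 * k → j + 1 ≤ p.parts i := fun i j hi hj => by
    have := (p.lt_durfee_iff (2 * k - 1)).mp (by omega)
    have := p.antitone' (show i ≤ 2 * k - 1 by omega)
    omega
  have hα : StrictSeq (2 * k) fun i => if i < 2 * k then p.parts i - i else 0 := by
    refine ⟨fun i hi => ?_, fun i hi => if_neg (by omega)⟩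
    have := hle i i hi hi
    have := p.antitone' (Nat.le_add_right i 1)
    simp only [hi, if_true]
    split_ifs <;> omega
  have hβ : StrictSeq (2 * k) fun j => if j < 2 * k then p.conj (j + 1) - j else 0 := by
    refine ⟨fun j hj => ?_, fun j hj => if_neg (by omega)⟩
    have := (p.lt_conj_succ_iff j j).mpr (hle j j hj hj)
    have : p.conj (j + 1 + 1) ≤ p.conj (j + 1) := le_of_forall_lt fun i hi => by
      rw [Ptn.lt_conj_succ_iff] at hi ⊢
      omega
    simp only [hj, if_true]
    split_ifs <;> omega
  refine ⟨⟨k, _, _, hα, hβ⟩, Ptn.eq_of_parts_eq fun i => ?_⟩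
  rcases lt_or_ge i (2 * k) with hi | hi
  · rw [toPtn_parts_of_lt _ hi]
    have := hle i i hi hi
    simp only [hi, if_true]
    omega
  · rw [toPtn_parts_of_le _ hi]
    refine eq_of_forall_lt_iff fun j => ?_
    rw [lt_columnCount_iff]
    dsimp only
    have hd : p.parts i ≤ 2 * k := by
      have := (p.lt_durfee_iff (2 * k)).not.mp (by omega)
      have := p.antitone' hi
      omega
    have hc := p.lt_conj_succ_iff i j
    constructor
    · rintro ⟨hj, h⟩
      rw [if_pos hj] at h
      omega
    · intro hj
      have hjk : j < 2 * k := by omega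
      rw [if_pos hjk]
      have := hc.mpr hj
      omega

end EvenFrobenius

/-- Distinct-part partitions `λ` with `ℓ(λ) ≡ 0` or `3 (mod 4)`, `λ_1 = a`, and
`λ_1 + λ_5 + λ_9 + ⋯ = b` are equinumerous with partitions `μ` of even Durfee size with
`h_1(μ) = a` and `h_1(μ) + h_3(μ) + h_5(μ) + ⋯ = b` (summing the diagonal hook lengths
at odd indices `i ≤ d(μ)`). -/
theorem mork_even_durfee (a b : ℕ) :
    {p : Ptn | p.Distinct ∧ (p.length % 4 = 0 ∨ p.length % 4 = 3) ∧
        p.parts 0 = a ∧ (∑ᶠ k : ℕ, p.parts (4 * k)) = b}.ncard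
      = {p : Ptn | Even p.durfee ∧ p.hook 1 = a ∧
          (∑ k ∈ Finset.range ((p.durfee + 1) / 2), p.hook (2 * k + 1)) = b}.ncard := by
  trans {x : EvenFrobenius | x.firstHook = a ∧ x.oddHookSum = b}.ncard
  · symm
    refine Set.ncard_congr (fun x _ => x.toDistinct) ?_ ?_ ?_
    · rintro x ⟨ha, hb⟩
      refine ⟨x.toDistinct_distinct, ?_, x.toDistinct_parts_zero.trans ha,
        x.finsum_toDistinct_parts.trans hb⟩
      have := x.toDistinct_length
      omega
    · exact fun x y _ _ h => EvenFrobenius.toDistinct_injective h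
    · rintro p ⟨hp, hl, ha, hb⟩
      obtain ⟨x, rfl⟩ := EvenFrobenius.exists_toDistinct_eq hp hl
      exact ⟨x, ⟨x.toDistinct_parts_zero.symm.trans ha,
        x.finsum_toDistinct_parts.symm.trans hb⟩, rfl⟩
  · refine Set.ncard_congr (fun x _ => x.toPtn) ?_ ?_ ?_
    · rintro x ⟨ha, hb⟩
      exact ⟨x.toPtn_durfee ▸ even_two_mul _, x.toPtn_hook_one.trans ha,
        x.sum_toPtn_hook.trans hb⟩
    · exact fun x y _ _ h => EvenFrobenius.toPtn_injective h
    · rintro p ⟨hp, ha, hb⟩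
      obtain ⟨x, rfl⟩ := EvenFrobenius.exists_toPtn_eq hp
      exact ⟨x, ⟨x.toPtn_hook_one.symm.trans ha, x.sum_toPtn_hook.symm.trans hb⟩, rfl⟩
end

section
/- Let μ be a nonempty partition with Durfee size d, and define a_{2i−1} = μ_i + μ'_i − 2i + 1 for 1 ≤ i ≤ d and a_{2i} = μ_i + μ'_{i+1} − 2i for 1 ≤ i ≤ d with μ_i ≥ i + 1; let L = 2d if μ_d ≥ d + 1 and L = 2d − 1 otherwise. Then a_1 > a_2 > ⋯ > a_L > 0 is a strictly decreasing sequence of positive integers (so the partition M(μ) = (a_1, …, a_L) has distinct parts), the odd-indexed entries satisfy a_1 + a_3 + a_5 + ⋯ = |μ|, and a_1 + a_2 + ⋯ + a_L = 2|μ| − ℓ(μ). -/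
theorem IsLowerSet.mem_iff_lt_ncard {S : Set ℕ} (hS : IsLowerSet S) (hf : S.Finite) (i : ℕ) :
    i ∈ S ↔ i < S.ncard := by
  constructor
  · intro hi
    have hsub : Set.Iio (i + 1) ⊆ S := fun k hk => hS (Nat.le_of_lt_succ hk) hi
    have := Set.ncard_le_ncard hsub hf
    rw [Set.ncard_Iio_nat] at this
    omega
  · intro hi
    by_contra hni
    have hsub : S ⊆ Set.Iio i := fun k hk => by
      by_contra hk'
      exact hni (hS (not_lt.mp hk') hk)
    have := Set.ncard_le_ncard hsub (Set.finite_Iio i)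
    rw [Set.ncard_Iio_nat] at this
    omega

theorem Finset.sum_range_two_mul_eq_sum_odd_add_sum_even {M : Type*} [AddCommMonoid M]
    (f : ℕ → M) (n : ℕ) :
    ∑ i ∈ Finset.range (2 * n), f (i + 1) =
      ∑ i ∈ Finset.range n, f (2 * i + 1) + ∑ i ∈ Finset.range n, f (2 * i + 2) := by
  induction n with
  | zero => simp
  | succ n ih =>
    rw [show 2 * (n + 1) = 2 * n + 1 + 1 by ring, Finset.sum_range_succ, Finset.sum_range_succ, ih,
      Finset.sum_range_succ, Finset.sum_range_succ]
    abel

namespace Ptn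

theorem le_parts_iff_lt_conj (p : Ptn) {i : ℕ} (hi : 1 ≤ i) (j : ℕ) :
    i ≤ p.parts j ↔ j < p.conj i :=
  IsLowerSet.mem_iff_lt_ncard (S := {j | i ≤ p.parts j})
    (fun _ _ hba ha => le_trans ha (p.antitone' hba))
    (p.finite_support'.subset fun _ hj => Nat.ne_of_gt (lt_of_lt_of_le hi hj)) j

theorem parts_ne_zero_iff_lt_length (p : Ptn) (j : ℕ) : p.parts j ≠ 0 ↔ j < p.length :=
  IsLowerSet.mem_iff_lt_ncard (S := Function.support p.parts)
    (fun _ _ hba ha => Nat.ne_of_gt (lt_of_lt_of_le (Nat.pos_of_ne_zero ha) (p.antitone' hba)))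
    p.finite_support' j

theorem succ_le_parts_iff_lt_durfee (p : Ptn) (i : ℕ) : i + 1 ≤ p.parts i ↔ i < p.durfee :=
  IsLowerSet.mem_iff_lt_ncard (S := {i | i + 1 ≤ p.parts i})
    (fun _ _ hba ha => le_trans (Nat.succ_le_succ hba) (le_trans ha (p.antitone' hba)))
    (p.finite_support'.subset fun _ hj => Nat.ne_of_gt (lt_of_lt_of_le (Nat.succ_pos _) hj)) i

theorem conj_anti (p : Ptn) {i j : ℕ} (hi : 1 ≤ i) (hij : i ≤ j) : p.conj j ≤ p.conj i := by
  by_contra! h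
  exact lt_irrefl _ ((p.le_parts_iff_lt_conj hi _).1
    (hij.trans ((p.le_parts_iff_lt_conj (hi.trans hij) _).2 h)))

theorem size_eq_sum_range (p : Ptn) {N : ℕ} (hN : p.length ≤ N) :
    p.size = ∑ j ∈ Finset.range N, p.parts j := by
  refine finsum_eq_sum_of_support_subset _ fun j hj => ?_
  have := (p.parts_ne_zero_iff_lt_length j).1 hj
  simp only [Finset.coe_range, Set.mem_Iio]
  omega

theorem durfee_le_length (p : Ptn) : p.durfee ≤ p.length := by
  by_contra! h
  have h1 := (p.succ_le_parts_iff_lt_durfee _).2 h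
  exact lt_irrefl _ ((p.parts_ne_zero_iff_lt_length p.length).1 (by omega))

theorem durfee_le_parts (p : Ptn) {j : ℕ} (hj : j < p.durfee) : p.durfee ≤ p.parts j := by
  have h1 := (p.succ_le_parts_iff_lt_durfee (p.durfee - 1)).2 (by omega)
  have h2 := p.antitone' (show j ≤ p.durfee - 1 by omega)
  omega

theorem parts_le_durfee (p : Ptn) {j : ℕ} (hj : p.durfee ≤ j) : p.parts j ≤ p.durfee := by
  have h1 := mt (p.succ_le_parts_iff_lt_durfee p.durfee).1 (lt_irrefl _)
  have h2 := p.antitone' hj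
  omega

theorem conj_eq_sum (p : Ptn) {i : ℕ} (hi : 1 ≤ i) :
    p.conj i = ∑ j ∈ Finset.range p.length, if i ≤ p.parts j then 1 else 0 := by
  rw [← Finset.card_filter]
  have : (Finset.range p.length).filter (fun j => i ≤ p.parts j) = Finset.range (p.conj i) := by
    ext j
    have h1 := p.le_parts_iff_lt_conj hi j
    have h2 := p.parts_ne_zero_iff_lt_length j
    simp only [Finset.mem_filter, Finset.mem_range]
    omega
  rw [this, Finset.card_range]

theorem sum_conj_eq_sum_min (p : Ptn) (n : ℕ) :
    ∑ i ∈ Finset.range n, p.conj (i + 1) =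
      ∑ j ∈ Finset.range p.length, min n (p.parts j) := by
  rw [Finset.sum_congr rfl fun i _ => p.conj_eq_sum (Nat.succ_pos i), Finset.sum_comm]
  refine Finset.sum_congr rfl fun j _ => ?_
  rw [← Finset.card_filter]
  have : (Finset.range n).filter (fun i => i + 1 ≤ p.parts j) =
      Finset.range (min n (p.parts j)) := by
    ext i
    simp only [Finset.mem_filter, Finset.mem_range]
    omega
  rw [this, Finset.card_range]

theorem sum_parts_add_sum_conj (p : Ptn) :
    ∑ i ∈ Finset.range p.durfee, p.parts i + ∑ i ∈ Finset.range p.durfee, p.conj (i + 1) =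
      p.size + p.durfee * p.durfee := by
  have hsplit : p.size = ∑ j ∈ Finset.range p.length, min p.durfee (p.parts j) +
      ∑ j ∈ Finset.range p.length, (p.parts j - p.durfee) := by
    rw [p.size_eq_sum_range le_rfl, ← Finset.sum_add_distrib]
    exact Finset.sum_congr rfl fun j _ => by omega
  have htail : ∑ j ∈ Finset.range p.durfee, (p.parts j - p.durfee) =
      ∑ j ∈ Finset.range p.length, (p.parts j - p.durfee) := by
    refine Finset.sum_subset (Finset.range_mono p.durfee_le_length) fun j _ hj => ?_
    have := p.parts_le_durfee (not_lt.1 fun h => hj (Finset.mem_range.2 h))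
    omega
  have hhead : ∑ j ∈ Finset.range p.durfee, p.parts j =
      ∑ j ∈ Finset.range p.durfee, (p.parts j - p.durfee) + p.durfee * p.durfee := by
    rw [show p.durfee * p.durfee = ∑ _j ∈ Finset.range p.durfee, p.durfee by simp,
      ← Finset.sum_add_distrib]
    refine Finset.sum_congr rfl fun j hj => ?_
    have := p.durfee_le_parts (Finset.mem_range.1 hj)
    omega
  rw [p.sum_conj_eq_sum_min]
  omega

theorem lt_conj_succ (p : Ptn) {i : ℕ} (hi : i < p.durfee) : i < p.conj (i + 1) :=
  (p.le_parts_iff_lt_conj (Nat.succ_pos i) i).1 ((p.succ_le_parts_iff_lt_durfee i).2 hi)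

theorem sum_hook_eq_size (p : Ptn) :
    ∑ i ∈ Finset.range p.durfee, p.hook (i + 1) = p.size := by
  have hodd : ∀ n : ℕ, ∑ i ∈ Finset.range n, (2 * i + 1) = n * n := fun n => by
    induction n with
    | zero => simp
    | succ n ih => rw [Finset.sum_range_succ, ih]; ring
  have hsum : ∑ i ∈ Finset.range p.durfee, p.hook (i + 1) +
      ∑ i ∈ Finset.range p.durfee, (2 * i + 1) =
      ∑ i ∈ Finset.range p.durfee, p.parts i +
        ∑ i ∈ Finset.range p.durfee, p.conj (i + 1) := by
    rw [← Finset.sum_add_distrib, ← Finset.sum_add_distrib]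
    refine Finset.sum_congr rfl fun i hi => ?_
    have hi := Finset.mem_range.1 hi
    have h1 := (p.succ_le_parts_iff_lt_durfee i).2 hi
    have h2 := p.lt_conj_succ hi
    simp only [hook, Nat.add_sub_cancel]
    omega
  have := p.sum_parts_add_sum_conj
  rw [hodd] at hsum
  omega

/-- The partition obtained by deleting the first column of the Young diagram. -/
def removeColumn (p : Ptn) : Ptn where
  parts i := p.parts i - 1
  antitone' _ _ h := Nat.sub_le_sub_right (p.antitone' h) 1
  finite_support' := p.finite_support'.subset fun i hi => by
    simp only [Function.mem_support] at hi ⊢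
    omega

theorem removeColumn_parts (p : Ptn) (i : ℕ) : p.removeColumn.parts i = p.parts i - 1 := rfl

theorem removeColumn_conj (p : Ptn) {i : ℕ} (hi : 1 ≤ i) :
    p.removeColumn.conj i = p.conj (i + 1) := by
  unfold conj
  congr 1
  ext j
  simp only [removeColumn_parts, Set.mem_ofPred_eq]
  omega

theorem removeColumn_size_add_length (p : Ptn) : p.removeColumn.size + p.length = p.size := by
  have hle : p.removeColumn.length ≤ p.length := by
    refine Set.ncard_le_ncard (fun i hi => ?_) p.finite_support'
    simp only [Function.mem_support, removeColumn_parts] at hi ⊢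
    omega
  have hlen : p.length = ∑ _j ∈ Finset.range p.length, 1 := by simp
  rw [p.removeColumn.size_eq_sum_range hle, p.size_eq_sum_range le_rfl]
  nth_rewrite 2 [hlen]
  rw [← Finset.sum_add_distrib]
  refine Finset.sum_congr rfl fun j hj => ?_
  have := (p.parts_ne_zero_iff_lt_length j).2 (Finset.mem_range.1 hj)
  rw [removeColumn_parts]
  omega

theorem removeColumn_durfee (p : Ptn) :
    p.removeColumn.durfee =
      if p.durfee + 1 ≤ p.parts (p.durfee - 1) then p.durfee else p.durfee - 1 := by
  have key : ∀ i, i < p.removeColumn.durfee ↔ i + 2 ≤ p.parts i := fun i => by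
    rw [← succ_le_parts_iff_lt_durfee, removeColumn_parts]
    omega
  have hlt : ∀ i, i < p.removeColumn.durfee → i < p.durfee := fun i hi =>
    (p.succ_le_parts_iff_lt_durfee i).1 (by have := (key i).1 hi; omega)
  have hle : p.removeColumn.durfee ≤ p.durfee := by
    by_contra! h
    exact lt_irrefl _ (hlt _ h)
  have hge : p.durfee - 1 ≤ p.removeColumn.durfee := by
    by_contra! h
    have h1 := p.durfee_le_parts (show p.removeColumn.durfee < p.durfee by omega)
    have h2 := mt (key _).2 (lt_irrefl _)
    omega
  have hlast := key (p.durfee - 1)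
  split_ifs with h
  · omega
  · omega

end Ptn

/-- Properties of the data of Mork's bijection. For a nonempty partition `μ` of Durfee
size `d`, with `a_{2i-1} = μ_i + μ'_i - 2i + 1` (for `1 ≤ i ≤ d`) and
`a_{2i} = μ_i + μ'_{i+1} - 2i` (for `1 ≤ i ≤ d` with `μ_i ≥ i + 1`), and
`L = 2d` if `μ_d ≥ d + 1`, `L = 2d - 1` otherwise: the sequence `a_1 > a_2 > ⋯ > a_L > 0`
is strictly decreasing and positive, the odd-indexed entries sum to `|μ|`, and all the
entries sum to `2|μ| - ℓ(μ)`. -/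
theorem mork_data (μ : Ptn) (hne : μ.parts 0 ≠ 0) (d : ℕ) (hd : d = μ.durfee)
    (L : ℕ) (hL : L = if d + 1 ≤ μ.parts (d - 1) then 2 * d else 2 * d - 1)
    (a : ℕ → ℕ)
    (ha₁ : ∀ i, 1 ≤ i → i ≤ d → a (2 * i - 1) = μ.parts (i - 1) + μ.conj i + 1 - 2 * i)
    (ha₂ : ∀ i, 1 ≤ i → i ≤ d → i + 1 ≤ μ.parts (i - 1) →
      a (2 * i) = μ.parts (i - 1) + μ.conj (i + 1) - 2 * i) :
    (∀ i, 1 ≤ i → i + 1 ≤ L → a (i + 1) < a i) ∧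
    (∀ i, 1 ≤ i → i ≤ L → 0 < a i) ∧
    (∑ i ∈ Finset.range d, a (2 * i + 1)) = μ.size ∧
    (∑ i ∈ Finset.range L, a (i + 1)) + μ.length = 2 * μ.size := by
  subst hd
  have hpos : 0 < μ.durfee := (μ.succ_le_parts_iff_lt_durfee 0).1 (Nat.pos_of_ne_zero hne)
  have hodd : ∀ i < μ.durfee, a (2 * i + 1) = μ.hook (i + 1) := fun i hi => by
    rw [Ptn.hook, ← ha₁ (i + 1) (by omega) (by omega)]
    congr 1
  have hrem := μ.removeColumn_durfee
  have heven : ∀ i < μ.removeColumn.durfee, a (2 * i + 2) = μ.removeColumn.hook (i + 1) ∧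
      i + 2 ≤ μ.parts i ∧ i < μ.conj (i + 2) := fun i hi => by
    have h1 := (μ.removeColumn.succ_le_parts_iff_lt_durfee i).2 hi
    have h2 := μ.removeColumn.lt_conj_succ hi
    rw [μ.removeColumn_parts] at h1
    rw [μ.removeColumn_conj (by omega)] at h2
    have hi' : i < μ.durfee := by split_ifs at hrem <;> omega
    have h3 := ha₂ (i + 1) (by omega) (by omega) (by simp only [Nat.add_sub_cancel]; omega)
    refine ⟨?_, by omega, h2⟩
    rw [show 2 * i + 2 = 2 * (i + 1) by ring, h3, Ptn.hook, μ.removeColumn_conj (by omega),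
      μ.removeColumn_parts]
    simp only [Nat.add_sub_cancel]
    omega
  have hoddval : ∀ i < μ.durfee, a (2 * i + 1) + 2 * i + 1 = μ.parts i + μ.conj (i + 1) ∧
      i + 1 ≤ μ.parts i ∧ i < μ.conj (i + 1) := fun i hi => by
    have h1 := (μ.succ_le_parts_iff_lt_durfee i).2 hi
    have h2 := μ.lt_conj_succ hi
    refine ⟨?_, h1, h2⟩
    rw [hodd i hi, Ptn.hook]
    simp only [Nat.add_sub_cancel]
    omega
  have hevenval : ∀ i < μ.removeColumn.durfee,
      a (2 * i + 2) + 2 * i + 2 = μ.parts i + μ.conj (i + 2) := fun i hi => by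
    obtain ⟨h1, h2, h3⟩ := heven i hi
    rw [h1, Ptn.hook, μ.removeColumn_conj (by omega), μ.removeColumn_parts]
    simp only [Nat.add_sub_cancel]
    rw [show i + 1 + 1 = i + 2 from rfl]
    omega
  have hL' : L = μ.durfee + μ.removeColumn.durfee := by
    rw [hL, hrem]
    split_ifs <;> omega
  have hcases : μ.removeColumn.durfee = μ.durfee ∨ μ.removeColumn.durfee + 1 = μ.durfee := by
    split_ifs at hrem <;> omega
  have hsum₁ : ∑ i ∈ Finset.range μ.durfee, a (2 * i + 1) = μ.size := by
    rw [← μ.sum_hook_eq_size]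
    exact Finset.sum_congr rfl fun i hi => hodd i (Finset.mem_range.1 hi)
  have hsum₂ : ∑ i ∈ Finset.range μ.removeColumn.durfee, a (2 * i + 2) = μ.removeColumn.size := by
    rw [← μ.removeColumn.sum_hook_eq_size]
    exact Finset.sum_congr rfl fun i hi => (heven i (Finset.mem_range.1 hi)).1
  refine ⟨fun i hi hiL => ?_, fun i hi hiL => ?_, hsum₁, ?_⟩
  · obtain ⟨k, rfl | rfl⟩ : ∃ k, i = 2 * k + 1 ∨ i = 2 * k + 2 := ⟨(i - 1) / 2, by omega⟩
    · have h1 := hoddval k (by omega)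
      have h2 := hevenval k (by omega)
      have h3 := μ.conj_anti (show 1 ≤ k + 1 by omega) (show k + 1 ≤ k + 2 by omega)
      rw [show 2 * k + 1 + 1 = 2 * k + 2 by ring]
      omega
    · have h1 := hoddval (k + 1) (by omega)
      have h2 := hevenval k (by omega)
      have h3 := μ.antitone' (show k ≤ k + 1 by omega)
      rw [show 2 * (k + 1) + 1 = 2 * k + 2 + 1 by ring, show k + 1 + 1 = k + 2 by ring] at h1
      omega
  · obtain ⟨k, rfl | rfl⟩ : ∃ k, i = 2 * k + 1 ∨ i = 2 * k + 2 := ⟨(i - 1) / 2, by omega⟩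
    · have h1 := hoddval k (by omega)
      omega
    · have h1 := hevenval k (by omega)
      have h2 := heven k (by omega)
      omega
  · have hlen := μ.removeColumn_size_add_length
    have htotal : ∑ i ∈ Finset.range L, a (i + 1) =
        ∑ i ∈ Finset.range μ.durfee, a (2 * i + 1) +
          ∑ i ∈ Finset.range μ.removeColumn.durfee, a (2 * i + 2) := by
      rw [hL']
      rcases hcases with h | h
      · rw [h, ← two_mul, Finset.sum_range_two_mul_eq_sum_odd_add_sum_even]
      · rw [← h, show ∀ e : ℕ, e + 1 + e = 2 * e + 1 from fun e => by ring,
          Finset.sum_range_succ, Finset.sum_range_two_mul_eq_sum_odd_add_sum_even, Finset.sum_range_succ]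
        ring
    rw [htotal, hsum₁, hsum₂]
    omega
end
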